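/- For every dimension d ≥ 1 and every t ∈ (0, 1/2], there exists a constant C_{d,t} > 0 with the following property: if A, B ⊆ ℝ^d are measurable sets of equal positive finite volume such that |tA + (1−t)B| < (1 + t^d)·|A|, then there is a translation vector v ∈ ℝ^d such that |co(A ∪ (B + v))| ≤ C_{d,t}·|A|. -/

import Mathlib

open MeasureTheory Pointwise

section

open Set Filter Topology ENNReal

/-- The Brunn–Minkowski inequality on the line, for compact sets. -/
theorem volume_add_le_of_isCompact {A B : Set ℝ} (hA : IsCompact A) (hB : IsCompact B)
    (hA0 : A.Nonempty) (hB0 : B.Nonempty) : volume A + volume B ≤ volume (A + B) := by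
  obtain ⟨a, ha, hamax⟩ := hA.exists_isGreatest hA0
  obtain ⟨b, hb, hbmin⟩ := hB.exists_isLeast hB0
  have h1 : volume A ≤ volume ((A + B) ∩ Iic (a + b)) := by
    rw [← measure_vadd volume b A]
    refine measure_mono ?_
    rintro _ ⟨x, hx, rfl⟩
    refine ⟨⟨x, hx, b, hb, by simp [add_comm]⟩, ?_⟩
    have := hamax hx
    simp only [vadd_eq_add, mem_Iic]
    linarith
  have h2 : volume B ≤ volume ((A + B) \ Iic (a + b)) := by
    rw [← measure_vadd volume a B, ← measure_sdiff_null (measure_singleton (μ := volume) (a + b))]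
    refine measure_mono ?_
    rintro _ ⟨⟨y, hy, rfl⟩, hne⟩
    refine ⟨⟨a, ha, y, hy, rfl⟩, ?_⟩
    have := hbmin hy
    simp only [vadd_eq_add, mem_Iic, not_le, mem_singleton_iff] at hne ⊢
    exact lt_of_le_of_ne (by linarith) (Ne.symm hne)
  calc volume A + volume B ≤ _ := add_le_add h1 h2
    _ = volume (A + B) := measure_inter_add_sdiff _ measurableSet_Iic

/-- The Brunn–Minkowski inequality on the line, for measurable sets. -/
theorem volume_add_le_of_measurableSet {A B E : Set ℝ} (hA : MeasurableSet A)
    (hB : MeasurableSet B) (hA0 : A.Nonempty) (hB0 : B.Nonempty) (hE : A + B ⊆ E) :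
    volume A + volume B ≤ volume E := by
  obtain ⟨a, ha⟩ := hA0
  obtain ⟨b, hb⟩ := hB0
  have key : ∀ K L : Set ℝ, IsCompact K → IsCompact L → K ⊆ A → L ⊆ B →
      volume K + volume L ≤ volume E := by
    intro K L hK hL hKA hLB
    calc volume K + volume L ≤ volume (insert a K) + volume (insert b L) := by
          gcongr <;> exact subset_insert _ _
      _ ≤ volume (insert a K + insert b L) :=
          volume_add_le_of_isCompact (hK.insert a) (hL.insert b) (by simp) (by simp)
      _ ≤ volume E := measure_mono ((add_subset_add (insert_subset ha hKA)
          (insert_subset hb hLB)).trans hE)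
  have key' : ∀ L : Set ℝ, IsCompact L → L ⊆ B → volume A + volume L ≤ volume E := by
    intro L hL hLB
    have hLE : volume L ≤ volume E := by
      simpa using key ∅ L isCompact_empty hL (empty_subset _) hLB
    refine add_le_of_le_tsub_right_of_le hLE ?_
    rw [hA.measure_eq_iSup_isCompact]
    exact iSup₂_le fun K hKA => iSup_le fun hK =>
      ENNReal.le_sub_of_add_le_right hL.measure_lt_top.ne (key K L hK hL hKA hLB)
  have hAE : volume A ≤ volume E := by simpa using key' ∅ isCompact_empty (empty_subset _)
  by_cases hAtop : volume A = ∞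
  · rw [hAtop, top_le_iff] at hAE
    simp [hAE]
  refine add_le_of_le_tsub_left_of_le hAE ?_
  rw [hB.measure_eq_iSup_isCompact]
  exact iSup₂_le fun L hLB => iSup_le fun hL =>
    ENNReal.le_sub_of_add_le_left hAtop (key' L hL hLB)

theorem lintegral_min_one_eq {α : Type*} [MeasurableSpace α] (μ : Measure α) {f : α → ℝ≥0∞}
    (hf : Measurable f) :
    ∫⁻ x, min (f x) 1 ∂μ = ∫⁻ s in Ioo (0 : ℝ) 1, μ {x | ENNReal.ofReal s < f x} := by
  have hfin : ∀ x, min (f x) 1 ≠ ∞ := fun x => (min_le_right _ _).trans_lt one_lt_top |>.ne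
  have h := lintegral_eq_lintegral_meas_lt μ (f := fun x => (min (f x) 1).toReal)
    (ae_of_all _ fun x => toReal_nonneg) (hf.min measurable_const).ennreal_toReal.aemeasurable
  simp only [ofReal_toReal (hfin _)] at h
  rw [h, ← Ioo_union_Ici_eq_Ioi (zero_lt_one : (0 : ℝ) < 1), lintegral_union measurableSet_Ici
    (by rw [Set.disjoint_left]; rintro x ⟨_, hx⟩ hx'; exact absurd hx' (not_le.2 hx))]
  have h0 : ∫⁻ s in Ici (1 : ℝ), μ {a | s < (min (f a) 1).toReal} = 0 := by
    rw [setLIntegral_congr_fun (g := fun _ => 0) measurableSet_Ici]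
    · simp
    · intro s hs
      have : {a | s < (min (f a) 1).toReal} = ∅ := by
        ext a
        simp only [mem_ofPred_eq, mem_empty_iff_false, iff_false, not_lt]
        refine le_trans ?_ (mem_Ici.1 hs)
        rw [← toReal_one]
        exact toReal_mono one_ne_top (min_le_right _ _)
      simp [this]
  rw [h0, add_zero]
  refine setLIntegral_congr_fun measurableSet_Ioo ?_
  intro s hs
  simp only
  congr 1
  ext x
  simp only [mem_ofPred_eq]
  rw [← ENNReal.ofReal_lt_iff_lt_toReal hs.1.le (hfin x), lt_min_iff, and_iff_left]
  simpa using hs.2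

theorem rpow_mul_rpow_le_add {t : ℝ} (ht0 : 0 < t) (ht1 : t < 1) (x y : ℝ≥0∞) :
    x ^ t * y ^ (1 - t) ≤ ENNReal.ofReal t * x + ENNReal.ofReal (1 - t) * y := by
  have ht1' : 0 < 1 - t := by linarith
  by_cases hx : x = ∞
  · simp [hx, ENNReal.mul_top, ht0]
  by_cases hy : y = ∞
  · rw [hy, ENNReal.mul_top (by simpa using ht1'), add_top]
    exact le_top
  lift x to NNReal using hx
  lift y to NNReal using hy
  have h := NNReal.geom_mean_le_arith_mean2_weighted ⟨t, ht0.le⟩ ⟨1 - t, ht1'.le⟩ x y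
    (NNReal.eq (add_sub_cancel t 1))
  rw [← ENNReal.coe_rpow_of_nonneg _ ht0.le, ← ENNReal.coe_rpow_of_nonneg _ ht1'.le,
    ENNReal.ofReal_eq_coe_nnreal ht0.le, ENNReal.ofReal_eq_coe_nnreal ht1'.le]
  exact_mod_cast h

/-- One-dimensional Prékopa–Leindler for functions with supremum one. -/
theorem lintegral_le_of_iSup_eq_one {t : ℝ} (ht0 : 0 < t) (ht1 : t < 1) {f g h : ℝ → ℝ≥0∞}
    (hf : Measurable f) (hg : Measurable g) (hh : Measurable h)
    (hf1 : ⨆ x, f x = 1) (hg1 : ⨆ x, g x = 1)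
    (hfgh : ∀ x y, f x ^ t * g y ^ (1 - t) ≤ h (t * x + (1 - t) * y)) :
    (∫⁻ x, f x) ^ t * (∫⁻ x, g x) ^ (1 - t) ≤ ∫⁻ x, h x := by
  have ht1' : 0 < 1 - t := by linarith
  have hfle : ∀ x, f x ≤ 1 := fun x => hf1 ▸ le_iSup f x
  have hgle : ∀ x, g x ≤ 1 := fun x => hg1 ▸ le_iSup g x
  have hf' : ∫⁻ x, f x = ∫⁻ s in Ioo (0 : ℝ) 1, volume {x | ENNReal.ofReal s < f x} := by
    rw [← lintegral_min_one_eq _ hf]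
    simp [min_eq_left (hfle _)]
  have hg' : ∫⁻ x, g x = ∫⁻ s in Ioo (0 : ℝ) 1, volume {x | ENNReal.ofReal s < g x} := by
    rw [← lintegral_min_one_eq _ hg]
    simp [min_eq_left (hgle _)]
  have hh' : ∫⁻ s in Ioo (0 : ℝ) 1, volume {x | ENNReal.ofReal s < h x} ≤ ∫⁻ x, h x := by
    rw [← lintegral_min_one_eq _ hh]
    exact lintegral_mono fun x => min_le_left _ _
  have hmeas : Measurable fun s : ℝ => volume {x | ENNReal.ofReal s < f x} := by
    refine Antitone.measurable fun a b hab => measure_mono fun x hx => ?_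
    exact (ENNReal.ofReal_le_ofReal hab).trans_lt hx
  refine (rpow_mul_rpow_le_add ht0 ht1 _ _).trans (le_trans ?_ hh')
  rw [hf', hg', ← lintegral_const_mul' _ _ ofReal_ne_top, ← lintegral_const_mul' _ _ ofReal_ne_top,
    ← lintegral_add_left (hmeas.const_mul _)]
  refine setLIntegral_mono' measurableSet_Ioo fun s hs => ?_
  have hs1 : ENNReal.ofReal s < 1 := by simpa using hs.2
  obtain ⟨x₀, hx₀⟩ : ∃ x, ENNReal.ofReal s < f x := by
    rw [← hf1] at hs1; exact lt_iSup_iff.1 hs1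
  obtain ⟨y₀, hy₀⟩ : ∃ x, ENNReal.ofReal s < g x := by
    rw [← hg1] at hs1; exact lt_iSup_iff.1 hs1
  have hsc : ∀ (r : ℝ) (hr : 0 < r) (E : Set ℝ), ENNReal.ofReal r * volume E = volume (r • E) := by
    intro r hr E
    rw [Measure.addHaar_smul]
    simp [abs_of_pos hr]
  rw [hsc t ht0, hsc (1 - t) ht1']
  refine volume_add_le_of_measurableSet
    ((measurableSet_lt measurable_const hf).const_smul_of_ne_zero ht0.ne')
    ((measurableSet_lt measurable_const hg).const_smul_of_ne_zero ht1'.ne')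
    ⟨_, smul_mem_smul_set hx₀⟩ ⟨_, smul_mem_smul_set hy₀⟩ ?_
  rintro _ ⟨_, ⟨x, hx, rfl⟩, _, ⟨y, hy, rfl⟩, rfl⟩
  simp only [mem_ofPred_eq, smul_eq_mul] at hx hy ⊢
  refine lt_of_lt_of_le ?_ (hfgh x y)
  calc ENNReal.ofReal s = ENNReal.ofReal s ^ t * ENNReal.ofReal s ^ (1 - t) := by
        rw [← ENNReal.rpow_add_of_nonneg _ _ ht0.le ht1'.le]; simp
    _ < _ := ENNReal.mul_lt_mul (ENNReal.rpow_lt_rpow hx ht0) (ENNReal.rpow_lt_rpow hy ht1')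

/-- The **Prékopa–Leindler inequality** on the line. -/
theorem prekopa_leindler_real {t : ℝ} (ht0 : 0 < t) (ht1 : t < 1) {f g h : ℝ → ℝ≥0∞}
    (hf : Measurable f) (hg : Measurable g) (hh : Measurable h)
    (hfgh : ∀ x y, f x ^ t * g y ^ (1 - t) ≤ h (t * x + (1 - t) * y)) :
    (∫⁻ x, f x) ^ t * (∫⁻ x, g x) ^ (1 - t) ≤ ∫⁻ x, h x := by
  have ht1' : 0 < 1 - t := by linarith
  have bdd : ∀ {f g : ℝ → ℝ≥0∞}, Measurable f → Measurable g →
      (∀ x y, f x ^ t * g y ^ (1 - t) ≤ h (t * x + (1 - t) * y)) →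
      ⨆ x, f x ≠ ∞ → ⨆ x, g x ≠ ∞ →
      (∫⁻ x, f x) ^ t * (∫⁻ x, g x) ^ (1 - t) ≤ ∫⁻ x, h x := by
    intro f g hf hg hfgh ha hb
    set a := ⨆ x, f x with ha_def
    set b := ⨆ x, g x with hb_def
    by_cases ha0 : a = 0
    · have : ∀ x, f x = 0 := fun x => le_zero_iff.1 (ha0 ▸ le_iSup f x)
      simp [this, ht0]
    by_cases hb0 : b = 0
    · have : ∀ x, g x = 0 := fun x => le_zero_iff.1 (hb0 ▸ le_iSup g x)
      simp [this, ht1']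
    set c := a ^ t * b ^ (1 - t) with hc
    have hc0 : c ≠ 0 := mul_ne_zero (by simp [ha0, ha]) (by simp [hb0, hb])
    have hct : c ≠ ∞ := mul_ne_top (by simp [ha0, ha]) (by simp [hb0, hb])
    have hcinv : c⁻¹ = a⁻¹ ^ t * b⁻¹ ^ (1 - t) := by
      rw [hc, ENNReal.mul_inv (by simp [ha0, ha]) (by simp [ha0, ha]), ENNReal.inv_rpow,
        ENNReal.inv_rpow]
    have h1 := lintegral_le_of_iSup_eq_one ht0 ht1 (hf.const_mul a⁻¹) (hg.const_mul b⁻¹)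
      (hh.const_mul c⁻¹)
      (by rw [← ENNReal.mul_iSup, ENNReal.inv_mul_cancel ha0 ha])
      (by rw [← ENNReal.mul_iSup, ENNReal.inv_mul_cancel hb0 hb]) (fun x y => by
        rw [ENNReal.mul_rpow_of_nonneg _ _ ht0.le, ENNReal.mul_rpow_of_nonneg _ _ ht1'.le,
          mul_mul_mul_comm, ← hcinv]
        gcongr
        exact hfgh x y)
    rw [lintegral_const_mul _ hf, lintegral_const_mul _ hg, lintegral_const_mul _ hh,
      ENNReal.mul_rpow_of_nonneg _ _ ht0.le, ENNReal.mul_rpow_of_nonneg _ _ ht1'.le,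
      mul_mul_mul_comm, ← hcinv] at h1
    exact (ENNReal.mul_le_mul_iff_right (ENNReal.inv_ne_zero.2 hct)
      (ENNReal.inv_ne_top.2 hc0)).1 h1
  have hmin : ∀ x : ℝ≥0∞, ⨆ k : ℕ, min x k = x := by
    intro x
    rw [← inf_iSup_eq, ENNReal.iSup_natCast]
    simp
  have hlim : ∀ {f : ℝ → ℝ≥0∞}, Measurable f → ⨆ k : ℕ, ∫⁻ x, min (f x) k = ∫⁻ x, f x := by
    intro f hf
    rw [← lintegral_iSup (fun k => hf.min measurable_const)
      (fun i j hij x => min_le_min le_rfl (by exact_mod_cast hij))]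
    simp [hmin]
  refine ENNReal.mul_le_of_forall_lt fun a ha b hb => ?_
  have ha' : a ^ t⁻¹ < ∫⁻ x, f x := by rwa [ENNReal.rpow_inv_lt_iff ht0]
  have hb' : b ^ (1 - t)⁻¹ < ∫⁻ x, g x := by rwa [ENNReal.rpow_inv_lt_iff ht1']
  rw [← hlim hf] at ha'
  rw [← hlim hg] at hb'
  obtain ⟨k, hk⟩ := lt_iSup_iff.1 ha'
  obtain ⟨l, hl⟩ := lt_iSup_iff.1 hb'
  rw [ENNReal.rpow_inv_lt_iff ht0] at hk
  rw [ENNReal.rpow_inv_lt_iff ht1'] at hl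
  refine (mul_le_mul' hk.le hl.le).trans (bdd (hf.min measurable_const) (hg.min measurable_const)
    (fun x y => le_trans ?_ (hfgh x y)) ?_ ?_)
  · gcongr <;> exact min_le_left _ _
  · exact ((iSup_le fun x => min_le_right _ _).trans_lt (natCast_lt_top k)).ne
  · exact ((iSup_le fun x => min_le_right _ _).trans_lt (natCast_lt_top l)).ne

/-- The **Prékopa–Leindler inequality**. -/
theorem prekopa_leindler {t : ℝ} (ht0 : 0 < t) (ht1 : t < 1) (n : ℕ)
    {f g h : (Fin n → ℝ) → ℝ≥0∞} (hf : Measurable f) (hg : Measurable g) (hh : Measurable h)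
    (hfgh : ∀ x y, f x ^ t * g y ^ (1 - t) ≤ h (t • x + (1 - t) • y)) :
    (∫⁻ x, f x) ^ t * (∫⁻ x, g x) ^ (1 - t) ≤ ∫⁻ x, h x := by
  induction n with
  | zero =>
    have h0 := hfgh default default
    rw [Subsingleton.elim (t • default + (1 - t) • default : Fin 0 → ℝ) default] at h0
    simpa only [volume_pi, Measure.pi_of_empty _ default, lintegral_dirac] using h0
  | succ n ih =>
    have e := (volume_preserving_piFinSuccAbove (fun _ : Fin (n + 1) => ℝ) 0).symm
    have hsplit : ∀ {f : (Fin (n + 1) → ℝ) → ℝ≥0∞}, Measurable f →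
        ∫⁻ x, f x = ∫⁻ x₀ : ℝ, ∫⁻ x : Fin n → ℝ, f (Fin.cons x₀ x) := by
      intro f hf
      rw [← e.lintegral_comp hf, Measure.volume_eq_prod, lintegral_prod]
      · simp [MeasurableEquiv.piFinSuccAbove, Fin.insertNthEquiv]
      · exact (hf.comp e.measurable).aemeasurable
    have hcons : Measurable fun p : ℝ × (Fin n → ℝ) => (Fin.cons p.1 p.2 : Fin (n + 1) → ℝ) := by
      convert e.measurable using 1
      ext p i
      simp [MeasurableEquiv.piFinSuccAbove, Fin.insertNthEquiv]
    rw [hsplit hf, hsplit hg, hsplit hh]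
    have hm : ∀ {f : (Fin (n + 1) → ℝ) → ℝ≥0∞}, Measurable f →
        Measurable fun p : ℝ × (Fin n → ℝ) => f (Fin.cons p.1 p.2) := fun hf => hf.comp hcons
    refine prekopa_leindler_real ht0 ht1 (hm hf).lintegral_prod_right' (hm hg).lintegral_prod_right'
      (hm hh).lintegral_prod_right' fun x₀ y₀ => ?_
    refine ih ((hm hf).comp measurable_prodMk_left) ((hm hg).comp measurable_prodMk_left)
      ((hm hh).comp measurable_prodMk_left) fun x y => ?_
    convert hfgh (Fin.cons x₀ x) (Fin.cons y₀ y) using 2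
    ext i
    refine Fin.cases ?_ (fun i => ?_) i <;> simp

end

section

open Set Filter Topology ENNReal

/-- Averaging: some translate of the subgroup of `N`-torsion points meets `X` in at least
`N * volume X` points. -/
theorem exists_card_toAddCircle_ge (N : ℕ) [NeZero N] {X : Set UnitAddCircle}
    (hX : MeasurableSet X) :
    ∃ (θ : UnitAddCircle) (s : Finset (ZMod N)), (∀ j ∈ s, θ + ZMod.toAddCircle j ∈ X) ∧
      N * volume X ≤ s.card := by
  classical
  have : IsProbabilityMeasure (volume : Measure UnitAddCircle) :=
    ⟨by rw [UnitAddCircle.measure_univ]⟩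
  have hsumint : ∫⁻ θ : UnitAddCircle, ∑ j : ZMod N,
      X.indicator (fun _ => (1 : ℝ≥0∞)) (θ + ZMod.toAddCircle j) = N * volume X := by
    rw [lintegral_finsetSum]
    · simp_rw [lintegral_add_right_eq_self (μ := (volume : Measure UnitAddCircle))
        (X.indicator fun _ => (1 : ℝ≥0∞))]
      simp [lintegral_indicator hX, ZMod.card]
    · intro j _
      exact (measurable_const.indicator hX).comp (measurable_add_const _)
  obtain ⟨θ, hθ⟩ := exists_lintegral_le (μ := (volume : Measure UnitAddCircle))
    (f := fun θ => ∑ j : ZMod N, X.indicator (fun _ => (1 : ℝ≥0∞)) (θ + ZMod.toAddCircle j))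
    (by rw [hsumint]; exact mul_ne_top (natCast_ne_top N) (measure_ne_top _ _))
  refine ⟨θ, Finset.univ.filter fun j => θ + ZMod.toAddCircle j ∈ X, by simp, ?_⟩
  rw [hsumint] at hθ
  refine hθ.trans (le_of_eq ?_)
  simp [indicator_apply]

theorem one_div_le_norm_toAddCircle (N : ℕ) [NeZero N] {k : ZMod N} (hk : k ≠ 0) :
    1 / (N : ℝ) ≤ ‖ZMod.toAddCircle k‖ := by
  have hN : (0 : ℝ) < N := by exact_mod_cast Nat.pos_of_ne_zero (NeZero.ne N)
  rw [ZMod.toAddCircle_apply, UnitAddCircle.norm_eq]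
  set m := round ((k.val : ℝ) / N)
  have h : ((k.val : ℝ) / N - m) = (((k.val : ℤ) - m * N : ℤ) : ℝ) / N := by
    push_cast; field_simp
  rw [h, abs_div, abs_of_pos hN]
  gcongr
  rw [← Int.cast_abs]
  have h0 : (k.val : ℤ) - m * N ≠ 0 := by
    intro h0
    apply hk
    have := congrArg (Int.cast : ℤ → ZMod N) h0
    simpa using this
  exact_mod_cast Int.one_le_abs h0

theorem card_le_volume_cthickening (N : ℕ) [NeZero N] {Z : Set UnitAddCircle}
    (θ : UnitAddCircle) (s : Finset (ZMod N)) (h : ∀ j ∈ s, θ + ZMod.toAddCircle j ∈ Z) :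
    (s.card : ℝ≥0∞) ≤ N * volume (Metric.cthickening (1 / (N : ℝ)) Z) := by
  have hN : (0 : ℝ) < N := by exact_mod_cast Nat.pos_of_ne_zero (NeZero.ne N)
  have hN1 : (1 : ℝ) ≤ N := by exact_mod_cast Nat.pos_of_ne_zero (NeZero.ne N)
  have hball : ∀ x : UnitAddCircle, N * volume (Metric.ball x (1 / (2 * N) : ℝ)) = 1 := by
    intro x
    rw [← measure_congr AddCircle.closedBall_ae_eq_ball, AddCircle.volume_closedBall]
    have : min (1 : ℝ) (2 * (1 / (2 * N))) = 1 / N := by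
      rw [min_eq_right]
      · field_simp
      · field_simp; exact hN1
    rw [this, ← ofReal_natCast, ← ofReal_mul hN.le, mul_one_div_cancel hN.ne', ofReal_one]
  have hsub : (⋃ j ∈ s, Metric.ball (θ + ZMod.toAddCircle j) (1 / (2 * N) : ℝ)) ⊆
      Metric.cthickening (1 / (N : ℝ)) Z := by
    intro x hx
    simp only [mem_iUnion, exists_prop] at hx
    obtain ⟨j, hj, hx⟩ := hx
    refine Metric.mem_cthickening_of_dist_le _ _ _ _ (h j hj) ?_
    refine (Metric.mem_ball.1 hx).le.trans ?_
    gcongr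
    linarith
  calc (s.card : ℝ≥0∞)
      = ∑ j ∈ s, N * volume (Metric.ball (θ + ZMod.toAddCircle j) (1 / (2 * N) : ℝ)) := by
        simp_rw [hball, Finset.sum_const, nsmul_one]
    _ = N * volume (⋃ j ∈ s, Metric.ball (θ + ZMod.toAddCircle j) (1 / (2 * N) : ℝ)) := by
        rw [measure_biUnion_finset, Finset.mul_sum]
        · intro i _ j _ hij
          refine Metric.ball_disjoint_ball ?_
          rw [dist_add_left, dist_eq_norm, ← map_sub]
          refine le_trans (le_of_eq ?_) (one_div_le_norm_toAddCircle N (sub_ne_zero.2 hij))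
          field_simp; norm_num
        · exact fun _ _ => measurableSet_ball
    _ ≤ _ := by gcongr

/-- **Raikov's theorem** for compact subsets of the circle. -/
theorem volume_add_le_unitAddCircle {X Y : Set UnitAddCircle} (hX : IsCompact X)
    (hY : IsCompact Y) (hX0 : X.Nonempty) (hY0 : Y.Nonempty)
    (hXY : volume X + volume Y ≤ 1) : volume X + volume Y ≤ volume (X + Y) := by
  obtain ⟨x₀, hx₀⟩ := hX0
  obtain ⟨y₀, hy₀⟩ := hY0
  rcases eq_or_ne (volume X) 0 with hXv | hXv
  · rw [hXv, zero_add, ← measure_vadd volume x₀ Y]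
    refine measure_mono ?_
    rintro _ ⟨y, hy, rfl⟩
    exact ⟨x₀, hx₀, y, hy, rfl⟩
  rcases eq_or_ne (volume Y) 0 with hYv | hYv
  · rw [hYv, add_zero, ← measure_vadd volume y₀ X]
    refine measure_mono ?_
    rintro _ ⟨x, hx, rfl⟩
    exact ⟨x, hx, y₀, hy₀, add_comm _ _⟩
  have key : ∀ p : ℕ, p.Prime → volume X + volume Y ≤
      volume (Metric.cthickening (1 / (p : ℝ)) (X + Y)) + ENNReal.ofReal (1 / (p : ℝ)) := by
    intro p hp
    have : NeZero p := ⟨hp.ne_zero⟩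
    obtain ⟨θ, s, hs, hsX⟩ := exists_card_toAddCircle_ge p hX.measurableSet
    obtain ⟨φ, u, hu, huY⟩ := exists_card_toAddCircle_ge p hY.measurableSet
    have hp0 : (p : ℝ≥0∞) ≠ 0 := by exact_mod_cast hp.ne_zero
    have hs0 : s.Nonempty := by
      rw [Finset.nonempty_iff_ne_empty]
      rintro rfl
      simp [hp.ne_zero, hXv] at hsX
    have hu0 : u.Nonempty := by
      rw [Finset.nonempty_iff_ne_empty]
      rintro rfl
      simp [hp.ne_zero, hYv] at huY
    have hcd := ZMod.cauchy_davenport hp hs0 hu0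
    have hcard := card_le_volume_cthickening p (Z := X + Y) (θ + φ) (s + u) (by
      intro j hj
      obtain ⟨a, ha, b, hb, rfl⟩ := Finset.mem_add.1 hj
      exact ⟨_, hs a ha, _, hu b hb, by simp only [map_add]; abel⟩)
    have hle : (p : ℝ≥0∞) * (volume X + volume Y) ≤ (s + u).card + 1 := by
      rcases min_le_iff.1 hcd with h | h
      · calc (p : ℝ≥0∞) * (volume X + volume Y) ≤ p * 1 := by gcongr
          _ ≤ (s + u).card := by rw [mul_one]; exact_mod_cast h
          _ ≤ _ := le_self_add
      · calc (p : ℝ≥0∞) * (volume X + volume Y) ≤ s.card + u.card := by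
              rw [mul_add]; gcongr
          _ ≤ _ := by exact_mod_cast (by omega : s.card + u.card ≤ (s + u).card + 1)
    refine (ENNReal.mul_le_mul_iff_right hp0 (natCast_ne_top p)).1 ?_
    refine hle.trans ?_
    rw [mul_add]
    gcongr
    rw [← ofReal_natCast, ← ofReal_mul (by positivity), mul_one_div_cancel
      (by exact_mod_cast hp.ne_zero), ofReal_one]
  have hlim : Tendsto (fun r : ℝ => volume (Metric.cthickening r (X + Y)) + ENNReal.ofReal r)
      (𝓝 0) (𝓝 (volume (X + Y) + ENNReal.ofReal 0)) :=
    (tendsto_measure_cthickening_of_isCompact (hX.add hY)).add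
      (ENNReal.continuous_ofReal.tendsto 0)
  rw [ofReal_zero, add_zero] at hlim
  have hlim2 := hlim.comp (tendsto_one_div_atTop_nhds_zero_nat (𝕜 := ℝ))
  refine ge_of_tendsto_of_frequently hlim2 ?_
  rw [Nat.frequently_atTop_iff_infinite]
  exact Nat.infinite_setOfPred_prime.mono fun p hp => key p hp

theorem volume_unitAddCircle_le_of_subset_image {U : Set UnitAddCircle} (hU : MeasurableSet U)
    {P : Set ℝ} (h : U ⊆ ((↑) : ℝ → UnitAddCircle) '' P) : volume U ≤ volume P := by
  have hT : (0 : ℝ) < 1 := one_pos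
  rw [AddCircle.add_projection_respects_measure 1 0 hU,
    (isAddFundamentalDomain_Ioc hT 0 volume).measure_eq_tsum P]
  refine (measure_mono ?_).trans (measure_iUnion_le _)
  rintro x ⟨hxU, hx⟩
  obtain ⟨q, hq, hqx⟩ := h hxU
  have hqx' : ((q : ℝ) : UnitAddCircle) = (x : ℝ) := hqx
  rw [QuotientAddGroup.eq] at hqx'
  refine mem_iUnion.2 ⟨⟨-q + x, hqx'⟩, ⟨q, hq, ?_⟩, hx⟩
  simp [AddSubgroup.vadd_def]

theorem volume_le_volume_image_coe {X : Set ℝ} (hX : IsCompact X) (hX0 : X.Nonempty)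
    (hd : ∀ p ∈ X, ∀ q ∈ X, |p - q| ≤ 1) :
    volume X ≤ volume (((↑) : ℝ → UnitAddCircle) '' X) := by
  obtain ⟨a, ha, hamin⟩ := hX.exists_isLeast hX0
  have hc : IsCompact (((↑) : ℝ → UnitAddCircle) '' X) :=
    hX.image (AddCircle.continuous_mk' 1)
  rw [AddCircle.add_projection_respects_measure 1 a hc.measurableSet,
    ← measure_sdiff_null (measure_singleton (μ := volume) a)]
  refine measure_mono ?_
  rintro x ⟨hx, hxa⟩
  refine ⟨⟨x, hx, rfl⟩, lt_of_le_of_ne (hamin hx) (Ne.symm hxa), ?_⟩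
  have := (abs_le.1 (hd x hx a ha)).2
  linarith

/-- If `X`, `Y` are compact sets of reals of diameter at most one and total measure at most one,
then any set meeting every class modulo `ℤ` of the points of `X + Y` has measure at least
`volume X + volume Y`. -/
theorem volume_add_le_of_forall_exists_add_int_mem {X Y P : Set ℝ} (hX : IsCompact X)
    (hY : IsCompact Y) (hX0 : X.Nonempty) (hY0 : Y.Nonempty)
    (hdX : ∀ p ∈ X, ∀ q ∈ X, |p - q| ≤ 1) (hdY : ∀ p ∈ Y, ∀ q ∈ Y, |p - q| ≤ 1)
    (hXY : volume X + volume Y ≤ 1)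
    (hP : ∀ x ∈ X, ∀ y ∈ Y, ∃ k : ℤ, x + y + k ∈ P) : volume X + volume Y ≤ volume P := by
  have hcX : IsCompact (((↑) : ℝ → UnitAddCircle) '' X) := hX.image (AddCircle.continuous_mk' 1)
  have hcY : IsCompact (((↑) : ℝ → UnitAddCircle) '' Y) := hY.image (AddCircle.continuous_mk' 1)
  calc volume X + volume Y
      ≤ volume (((↑) : ℝ → UnitAddCircle) '' X) + volume (((↑) : ℝ → UnitAddCircle) '' Y) :=
        add_le_add (volume_le_volume_image_coe hX hX0 hdX) (volume_le_volume_image_coe hY hY0 hdY)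
    _ ≤ volume (((↑) : ℝ → UnitAddCircle) '' X + ((↑) : ℝ → UnitAddCircle) '' Y) := by
        refine volume_add_le_unitAddCircle hcX hcY (hX0.image _) (hY0.image _) (le_trans ?_ hXY)
        exact add_le_add
          (volume_unitAddCircle_le_of_subset_image hcX.measurableSet Subset.rfl)
          (volume_unitAddCircle_le_of_subset_image hcY.measurableSet Subset.rfl)
    _ ≤ volume P := by
        refine volume_unitAddCircle_le_of_subset_image (hcX.add hcY).measurableSet ?_
        rintro _ ⟨_, ⟨x, hx, rfl⟩, _, ⟨y, hy, rfl⟩, rfl⟩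
        obtain ⟨k, hk⟩ := hP x hx y hy
        refine ⟨_, hk, ?_⟩
        simp

end

section

open Set Filter Topology ENNReal

theorem mul_volume_le_of_le_volume_fibre {n : ℕ} {K : Set (ℝ × (Fin n → ℝ))}
    (hK : MeasurableSet K) {G : Set (Fin n → ℝ)} {m : ℝ≥0∞}
    (h : ∀ z ∈ G, m ≤ volume ((fun s : ℝ => (s, z)) ⁻¹' K)) : m * volume G ≤ volume K := by
  rw [Measure.volume_eq_prod, Measure.prod_apply_symm hK]
  refine le_trans ?_ (mul_meas_ge_le_lintegral (measurable_measure_prodMk_right hK) m)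
  gcongr
  exact h

theorem volume_le_mul_volume_image_snd {n : ℕ} {K : Set (ℝ × (Fin n → ℝ))}
    (hK : IsCompact K) {m : ℝ≥0∞}
    (h : ∀ z, volume ((fun s : ℝ => (s, z)) ⁻¹' K) ≤ m) :
    volume K ≤ m * volume (Prod.snd '' K) := by
  have hm : MeasurableSet (Prod.snd '' K) := (hK.image continuous_snd).measurableSet
  rw [Measure.volume_eq_prod, Measure.prod_apply_symm hK.measurableSet,
    ← lintegral_indicator_const hm]
  refine lintegral_mono fun z => ?_
  by_cases hz : z ∈ Prod.snd '' K
  · simpa [indicator_of_mem hz] using h z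
  · have : (fun s : ℝ => (s, z)) ⁻¹' K = ∅ := by
      ext s
      simp only [mem_preimage, mem_empty_iff_false, iff_false]
      exact fun hs => hz ⟨_, hs, rfl⟩
    simp [this]

/-- A Brunn–Minkowski inequality modulo the integer translations along the first coordinate. -/
theorem rpow_volume_mul_le_of_forall_exists_add_int_mem {n : ℕ} {t : ℝ} (ht0 : 0 < t)
    (ht1 : t < 1) {A B P : Set (ℝ × (Fin n → ℝ))} (hA : IsCompact A) (hB : IsCompact B)
    (hP : MeasurableSet P)
    (hdA : ∀ x p q, (p, x) ∈ A → (q, x) ∈ A → t * |p - q| ≤ 1)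
    (hdB : ∀ x p q, (p, x) ∈ B → (q, x) ∈ B → (1 - t) * |p - q| ≤ 1)
    (hfA : ∀ x, ENNReal.ofReal t * volume ((fun s : ℝ => (s, x)) ⁻¹' A) ≤ 1 / 2)
    (hfB : ∀ x, ENNReal.ofReal (1 - t) * volume ((fun s : ℝ => (s, x)) ⁻¹' B) ≤ 1 / 2)
    (h : ∀ s ∈ t • A + (1 - t) • B, ∃ k : ℤ, s + ((k : ℝ), 0) ∈ P) :
    volume A ^ t * volume B ^ (1 - t) ≤ volume P := by
  have ht1' : 0 < 1 - t := by linarith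
  have hfib : ∀ {K : Set (ℝ × (Fin n → ℝ))}, IsCompact K → ∀ z,
      IsCompact ((fun s : ℝ => (s, z)) ⁻¹' K) := by
    intro K hK z
    refine (hK.image continuous_fst).of_isClosed_subset
      (hK.isClosed.preimage (by fun_prop)) ?_
    exact fun s hs => ⟨_, hs, rfl⟩
  rw [Measure.volume_eq_prod, Measure.prod_apply_symm hA.measurableSet,
    Measure.prod_apply_symm hB.measurableSet, Measure.prod_apply_symm hP]
  refine prekopa_leindler ht0 ht1 n (measurable_measure_prodMk_right hA.measurableSet)
    (measurable_measure_prodMk_right hB.measurableSet) (measurable_measure_prodMk_right hP) ?_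
  intro x y
  rcases ((fun s : ℝ => (s, x)) ⁻¹' A).eq_empty_or_nonempty with hx | hx
  · simp [hx, zero_rpow_of_pos ht0]
  rcases ((fun s : ℝ => (s, y)) ⁻¹' B).eq_empty_or_nonempty with hy | hy
  · simp [hy, zero_rpow_of_pos ht1']
  refine (rpow_mul_rpow_le_add ht0 ht1 _ _).trans ?_
  have hvA : ENNReal.ofReal t * volume ((fun s : ℝ => (s, x)) ⁻¹' A) =
      volume (t • ((fun s : ℝ => (s, x)) ⁻¹' A)) := by
    simp [Measure.addHaar_smul, abs_of_pos ht0]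
  have hvB : ENNReal.ofReal (1 - t) * volume ((fun s : ℝ => (s, y)) ⁻¹' B) =
      volume ((1 - t) • ((fun s : ℝ => (s, y)) ⁻¹' B)) := by
    simp [Measure.addHaar_smul, abs_of_pos ht1']
  have hsum : ENNReal.ofReal t * volume ((fun s : ℝ => (s, x)) ⁻¹' A) +
      ENNReal.ofReal (1 - t) * volume ((fun s : ℝ => (s, y)) ⁻¹' B) ≤ 1 :=
    (add_le_add (hfA x) (hfB y)).trans (ENNReal.add_halves 1).le
  rw [hvA, hvB] at hsum ⊢
  refine volume_add_le_of_forall_exists_add_int_mem ((hfib hA x).smul t) ((hfib hB y).smul (1 - t))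
    hx.smul_set hy.smul_set ?_ ?_ hsum ?_
  · rintro _ ⟨p, hp, rfl⟩ _ ⟨q, hq, rfl⟩
    simpa [← mul_sub, abs_mul, abs_of_pos ht0] using hdA x p q hp hq
  · rintro _ ⟨p, hp, rfl⟩ _ ⟨q, hq, rfl⟩
    simpa [← mul_sub, abs_mul, abs_of_pos ht1'] using hdB y p q hp hq
  · rintro _ ⟨p, hp, rfl⟩ _ ⟨q, hq, rfl⟩
    obtain ⟨k, hk⟩ := h (t • (p, x) + (1 - t) • (q, y))
      ⟨_, smul_mem_smul_set hp, _, smul_mem_smul_set hq, rfl⟩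
    refine ⟨k, ?_⟩
    simpa using hk

/-- A compact set splits off a measurable set of representatives of its classes modulo integer
translations along the first coordinate, disjoint from any `D` with `D - (1, 0) ⊆ S`. -/
theorem exists_measurableSet_representatives {n : ℕ} {S D : Set (ℝ × (Fin n → ℝ))}
    (hS : IsCompact S) (hDS : D ⊆ S) (hD : ∀ s ∈ D, s - (1, 0) ∈ S) :
    ∃ P, MeasurableSet P ∧ (∀ s ∈ S, ∃ k : ℤ, s + ((k : ℝ), 0) ∈ P) ∧
      volume D + volume P ≤ volume S := by
  have hP : MeasurableSet (S ∩ ⋂ k : ℕ, (fun s => s - (((k : ℝ) + 1), (0 : Fin n → ℝ))) ⁻¹' Sᶜ) := by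
    refine hS.measurableSet.inter (MeasurableSet.iInter fun k => ?_)
    exact (hS.measurableSet.compl).preimage (by fun_prop)
  refine ⟨_, hP, ?_, ?_⟩
  · intro s hs
    obtain ⟨m, hm⟩ := (hS.image continuous_fst).isBounded.bddBelow
    classical
    let Q : ℕ → Prop := fun k => s - ((k : ℝ), (0 : Fin n → ℝ)) ∈ S
    have hQ0 : Q 0 := by simpa [Q, Prod.mk_zero_zero] using hs
    obtain ⟨N, hN⟩ := exists_nat_gt (s.1 - m)
    have hQN : ∀ k, Q k → k ≤ N := by
      intro k hk
      have := hm ⟨_, hk, rfl⟩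
      simp only [Prod.fst_sub] at this
      exact_mod_cast (by linarith : (k : ℝ) ≤ N)
    have hg := Nat.findGreatest_spec (P := Q) (Nat.zero_le N) hQ0
    set k := Nat.findGreatest Q N
    refine ⟨-k, ?_⟩
    have he : s + (((-k : ℤ) : ℝ), (0 : Fin n → ℝ)) = s - ((k : ℝ), 0) := by
      ext <;> simp [sub_eq_add_neg]
    rw [he]
    refine ⟨hg, mem_iInter.2 fun j hj => ?_⟩
    have hj' : Q (k + (j + 1)) := by
      convert! hj using 1
      ext <;> simp
      ring
    have := Nat.le_findGreatest (hQN _ hj') hj'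
    omega
  · rw [← measure_union _ hP]
    · exact measure_mono (union_subset hDS inter_subset_left)
    · rw [disjoint_left]
      intro s hsD hsP
      have := mem_iInter.1 hsP.2 0
      simp only [Nat.cast_zero, zero_add, mem_preimage, mem_compl_iff] at this
      exact this (hD s hsD)

theorem mul_volume_image_snd_le {n : ℕ} {t u : ℝ} (ht0 : 0 < t) (hu0 : 0 < u)
    {A B : Set (ℝ × (Fin n → ℝ))} (hA : IsCompact A) (hB : IsCompact B) (y : Fin n → ℝ)
    {m : ℝ} (hm : 0 ≤ m) (h : ENNReal.ofReal m ≤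
      ENNReal.ofReal u * volume ((fun s : ℝ => (s, y)) ⁻¹' B)) :
    ENNReal.ofReal (m * t ^ n) * volume (Prod.snd '' A) ≤ volume (t • A + u • B) := by
  have hG : ENNReal.ofReal (m * t ^ n) * volume (Prod.snd '' A) =
      ENNReal.ofReal m * volume ((u • y) +ᵥ (t • (Prod.snd '' A))) := by
    rw [measure_vadd, Measure.addHaar_smul, ENNReal.ofReal_mul hm, mul_assoc]
    simp [abs_of_pos ht0]
  rw [hG]
  refine mul_volume_le_of_le_volume_fibre ((hA.smul t).add (hB.smul u)).measurableSet ?_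
  rintro _ ⟨_, ⟨_, ⟨a, ha, rfl⟩, rfl⟩, rfl⟩
  have hvB : ENNReal.ofReal u * volume ((fun s : ℝ => (s, y)) ⁻¹' B) =
      volume ((t * a.1) +ᵥ (u • ((fun s : ℝ => (s, y)) ⁻¹' B))) := by
    rw [measure_vadd]
    simp [Measure.addHaar_smul, abs_of_pos hu0]
  rw [hvB] at h
  refine h.trans (measure_mono ?_)
  rintro _ ⟨_, ⟨b, hb, rfl⟩, rfl⟩
  refine ⟨_, smul_mem_smul_set ha, _, smul_mem_smul_set hb, ?_⟩
  ext <;> simp [add_comm]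

theorem volume_le_of_forall_fibre_le {n : ℕ} {t : ℝ} (ht0 : 0 < t) (ht2 : t ≤ 1 / 2)
    {A B : Set (ℝ × (Fin n → ℝ))} (hA : IsCompact A) (hB : IsCompact B) {W : ℝ≥0∞}
    (hW0 : W ≠ 0) (hWA : W ≤ volume A) (hWB : W ≤ volume B)
    (he : (∃ a ∈ A, ∃ b ∈ A, t • (a - b) = (1, 0)) ∨
      ∃ a ∈ B, ∃ b ∈ B, (1 - t) • (a - b) = (1, 0))
    (hdA : ∀ x p q, (p, x) ∈ A → (q, x) ∈ A → t * |p - q| ≤ 1)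
    (hdB : ∀ x p q, (p, x) ∈ B → (q, x) ∈ B → (1 - t) * |p - q| ≤ 1)
    (hfA : ∀ x, ENNReal.ofReal t * volume ((fun s : ℝ => (s, x)) ⁻¹' A) ≤ 1 / 2)
    (hfB : ∀ x, ENNReal.ofReal (1 - t) * volume ((fun s : ℝ => (s, x)) ⁻¹' B) ≤ 1 / 2) :
    ENNReal.ofReal (1 + t ^ (n + 1)) * W ≤ volume (t • A + (1 - t) • B) := by
  have ht1 : t < 1 := by linarith
  have ht1' : 0 < 1 - t := by linarith
  have hS : IsCompact (t • A + (1 - t) • B) := (hA.smul t).add (hB.smul (1 - t))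
  have hsmul : ∀ {r : ℝ}, t ≤ r → ∀ {K : Set (ℝ × (Fin n → ℝ))}, W ≤ volume K →
      ∀ v : ℝ × (Fin n → ℝ), ENNReal.ofReal (t ^ (n + 1)) * W ≤ volume (v +ᵥ r • K) := by
    intro r hr K hK v
    have : (volume : Measure (ℝ × (Fin n → ℝ))).IsAddHaarMeasure := by
      rw [Measure.volume_eq_prod]; infer_instance
    rw [measure_vadd, Measure.addHaar_smul]
    have : Module.finrank ℝ (ℝ × (Fin n → ℝ)) = n + 1 := by simp [add_comm]
    rw [this]
    gcongr
    exact (pow_le_pow_left₀ ht0.le hr _).trans (le_abs_self _)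
  have hD : ∃ D ⊆ t • A + (1 - t) • B, (∀ s ∈ D, s - (1, 0) ∈ t • A + (1 - t) • B) ∧
      ENNReal.ofReal (t ^ (n + 1)) * W ≤ volume D := by
    rcases he with ⟨a, ha, b, hb, hab⟩ | ⟨a, ha, b, hb, hab⟩
    · refine ⟨(t • a) +ᵥ ((1 - t) • B), ?_, ?_, hsmul (by linarith) hWB _⟩
      · rintro _ ⟨y, hy, rfl⟩
        exact ⟨_, smul_mem_smul_set ha, y, hy, rfl⟩
      · rintro _ ⟨y, hy, rfl⟩
        refine ⟨_, smul_mem_smul_set hb, y, hy, ?_⟩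
        rw [← hab]
        simp only [vadd_eq_add, smul_sub]
        abel
    · refine ⟨((1 - t) • a) +ᵥ (t • A), ?_, ?_, hsmul le_rfl hWA _⟩
      · rintro _ ⟨x, hx, rfl⟩
        exact ⟨x, hx, _, smul_mem_smul_set ha, add_comm _ _⟩
      · rintro _ ⟨x, hx, rfl⟩
        refine ⟨x, hx, _, smul_mem_smul_set hb, ?_⟩
        rw [← hab]
        simp only [vadd_eq_add, smul_sub]
        abel
  obtain ⟨D, hDS, hDe, hDv⟩ := hD
  obtain ⟨P, hPm, hPS, hPv⟩ := exists_measurableSet_representatives hS hDS hDe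
  have hWP : W ≤ volume P := by
    calc W = W ^ t * W ^ (1 - t) := by
          rcases eq_or_ne W ⊤ with rfl | hW
          · simp [top_rpow_of_pos ht0, top_rpow_of_pos ht1']
          · rw [← ENNReal.rpow_add _ _ hW0 hW]; simp
      _ ≤ volume A ^ t * volume B ^ (1 - t) := by gcongr
      _ ≤ volume P :=
          rpow_volume_mul_le_of_forall_exists_add_int_mem ht0 ht1 hA hB hPm hdA hdB hfA hfB hPS
  calc ENNReal.ofReal (1 + t ^ (n + 1)) * W = ENNReal.ofReal (t ^ (n + 1)) * W + W := by
        rw [ENNReal.ofReal_add zero_le_one (by positivity), ofReal_one, add_mul, one_mul, add_comm]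
    _ ≤ volume D + volume P := add_le_add hDv hWP
    _ ≤ _ := hPv

theorem mul_volume_image_snd_le_of_volume_lt {n : ℕ} {t : ℝ} (ht0 : 0 < t) (ht2 : t ≤ 1 / 2)
    {A B : Set (ℝ × (Fin n → ℝ))} (hA : IsCompact A) (hB : IsCompact B) {W : ℝ≥0∞}
    (hW0 : W ≠ 0) (hWtop : W ≠ ⊤) (hWA : W ≤ volume A) (hWB : W ≤ volume B)
    (hS : volume (t • A + (1 - t) • B) < ENNReal.ofReal (1 + t ^ (n + 1)) * W)
    (he : (∃ a ∈ A, ∃ b ∈ A, t • (a - b) = (1, 0)) ∨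
      ∃ a ∈ B, ∃ b ∈ B, (1 - t) • (a - b) = (1, 0))
    (hdA : ∀ x p q, (p, x) ∈ A → (q, x) ∈ A → t * |p - q| ≤ 1)
    (hdB : ∀ x p q, (p, x) ∈ B → (q, x) ∈ B → (1 - t) * |p - q| ≤ 1) :
    ENNReal.ofReal (t ^ n * (1 - t) ^ (n + 1) / 8) * volume (Prod.snd '' A) ≤ 2 * W := by
  have ht1' : 0 < 1 - t := by linarith
  have hS2 : volume (t • A + (1 - t) • B) ≤ 2 * W := by
    refine hS.le.trans ?_
    gcongr
    refine ENNReal.ofReal_le_of_le_toReal ?_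
    have : t ^ (n + 1) ≤ 1 := pow_le_one₀ ht0.le (by linarith)
    simp only [toReal_ofNat]
    linarith
  have hhalf : ENNReal.ofReal (1 / 2) = 1 / 2 := by
    rw [ENNReal.ofReal_div_of_pos two_pos]; simp
  have hone : (1 - t) ^ (n + 1) ≤ 1 := pow_le_one₀ ht1'.le (by linarith)
  by_cases hfB : ∀ x, ENNReal.ofReal (1 - t) * volume ((fun s : ℝ => (s, x)) ⁻¹' B) ≤ 1 / 2
  · by_cases hfA : ∀ x, ENNReal.ofReal t * volume ((fun s : ℝ => (s, x)) ⁻¹' A) ≤ 1 / 2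
    · exact absurd (volume_le_of_forall_fibre_le ht0 ht2 hA hB hW0 hWA hWB he hdA hdB hfA hfB)
        (not_le.2 hS)
    push Not at hfA
    obtain ⟨x, hx⟩ := hfA
    have h1 := mul_volume_image_snd_le ht1' ht0 hB hA x (m := 1 / 2) (by norm_num)
      (by rw [hhalf]; exact hx.le)
    rw [add_comm] at h1
    have h2 : ∃ y, ENNReal.ofReal ((1 - t) ^ n / 8) ≤
        volume ((fun s : ℝ => (s, y)) ⁻¹' B) := by
      by_contra! hcon
      have h3 := volume_le_mul_volume_image_snd hB fun y => (hcon y).le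
      have h4 : 2 * W + 2 * W ≤ 2 * W := by
        calc 2 * W + 2 * W = 4 * W := by rw [← add_mul]; norm_num
          _ ≤ 4 * (ENNReal.ofReal ((1 - t) ^ n / 8) * volume (Prod.snd '' B)) := by
              gcongr; exact hWB.trans h3
          _ = ENNReal.ofReal (1 / 2 * (1 - t) ^ n) * volume (Prod.snd '' B) := by
              rw [← mul_assoc, ← ofReal_ofNat, ← ENNReal.ofReal_mul (by norm_num)]
              congr 2; ring
          _ ≤ 2 * W := h1.trans hS2
      have h2W : 2 * W ≠ ⊤ := mul_ne_top (by norm_num) hWtop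
      have := (ENNReal.add_le_add_iff_left h2W).1 (h4.trans_eq (add_zero _).symm)
      simp [hW0] at this
    obtain ⟨y, hy⟩ := h2
    refine le_trans (le_of_eq ?_) ((mul_volume_image_snd_le ht0 ht1' hA hB y
      (m := (1 - t) * ((1 - t) ^ n / 8)) (by positivity) ?_).trans hS2)
    · congr 2; ring
    · rw [ENNReal.ofReal_mul ht1'.le]
      gcongr
  · push Not at hfB
    obtain ⟨y, hy⟩ := hfB
    refine le_trans ?_ ((mul_volume_image_snd_le ht0 ht1' hA hB y (m := 1 / 2) (by norm_num)
      (by rw [hhalf]; exact hy.le)).trans hS2)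
    gcongr
    have : 0 ≤ t ^ n := by positivity
    nlinarith

end

section

open Set Filter Topology ENNReal

/-- A form of the Loomis–Whitney inequality for a set contained in a cube. -/
theorem mul_volume_le_of_volume_projections_le {n : ℕ} {X : Set (Fin (n + 1) → ℝ)}
    (hX : IsCompact X) {L : ℝ} (a : Fin (n + 1) → ℝ)
    (hXa : ∀ x ∈ X, ∀ i, x i ∈ Icc (a i) (a i + L)) {M : ℝ≥0∞}
    (hM : ∀ i : Fin (n + 1), volume ((fun x j => x (i.succAbove j)) '' X) ≤ M) :
    ENNReal.ofReal L * volume X ≤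
      ((n + 1) * (ENNReal.ofReal L * M)) ^ (1 + 1 / ((n : ℝ) + 1)) := by
  have hn : (0 : ℝ) < n + 1 := by positivity
  set Y : Fin (n + 1) → Set (Fin n → ℝ) := fun i => (fun x j => x (i.succAbove j)) '' X with hY
  have hYm : ∀ i, MeasurableSet (Y i) := fun i => (hX.image (by fun_prop)).measurableSet
  set F : Fin (n + 1) → Set (Fin (n + 1) → ℝ) := fun i =>
    MeasurableEquiv.piFinSuccAbove (fun _ => ℝ) i ⁻¹' (Icc (a i) (a i + L) ×ˢ Y i) with hF
  have hFm : ∀ i, MeasurableSet (F i) := fun i =>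
    (measurableSet_Icc.prod (hYm i)).preimage (MeasurableEquiv.measurable _)
  have hFv : ∀ i, volume (F i) ≤ ENNReal.ofReal L * M := by
    intro i
    rw [hF, (volume_preserving_piFinSuccAbove (fun _ => ℝ) i).measure_preimage_equiv,
      Measure.volume_eq_prod, Measure.prod_prod, Real.volume_Icc, add_sub_cancel_left]
    gcongr
    exact hM i
  set f : (Fin (n + 1) → ℝ) → ℝ≥0∞ := fun x => ∑ i, (F i).indicator 1 x with hf
  have hfm : Measurable f := Finset.measurable_sum _ fun i _ => measurable_one.indicator (hFm i)
  have hfint : ∫⁻ x, f x ≤ (n + 1) * (ENNReal.ofReal L * M) := by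
    rw [hf, lintegral_finsetSum _ fun i _ => measurable_one.indicator (hFm i)]
    calc ∑ i, ∫⁻ x, (F i).indicator 1 x = ∑ i, volume (F i) := by
          simp_rw [lintegral_indicator_one (hFm _)]
      _ ≤ ∑ i : Fin (n + 1), ENNReal.ofReal L * M := Finset.sum_le_sum fun i _ => hFv i
      _ = _ := by simp
  have hfle : ∀ i x, (F i).indicator 1 x ≤ f x := fun i x =>
    Finset.single_le_sum (f := fun i => (F i).indicator 1 x) (fun _ _ => zero_le) (Finset.mem_univ i)
  have hXF : ∀ x ∈ X, ∀ i, ∀ s ∈ Icc (a i) (a i + L), Function.update x i s ∈ F i := by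
    intro x hx i s hs
    refine ⟨?_, x, hx, ?_⟩
    · change Function.update x i s i ∈ _
      rwa [Function.update_self]
    · ext j
      exact (Function.update_of_ne (Fin.succAbove_ne i j) s x).symm
  have h1 : ∀ x ∈ X, 1 ≤ f x := by
    intro x hx
    refine le_trans ?_ (hfle 0 x)
    have := hXF x hx 0 (x 0) (hXa x hx 0)
    rw [Function.update_eq_self] at this
    rw [indicator_of_mem this, Pi.one_apply]
  have h2 : ∀ x ∈ X, ∀ i, ENNReal.ofReal L ≤ ∫⁻ s, f (Function.update x i s) := by
    intro x hx i
    calc ENNReal.ofReal L = ∫⁻ s, (Icc (a i) (a i + L)).indicator 1 s := by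
          rw [lintegral_indicator_one measurableSet_Icc, Real.volume_Icc, add_sub_cancel_left]
      _ ≤ _ := by
          refine lintegral_mono fun s => ?_
          by_cases hs : s ∈ Icc (a i) (a i + L)
          · refine le_trans ?_ (hfle i _)
            rw [indicator_of_mem hs, indicator_of_mem (hXF x hx i s hs)]
            simp
          · simp [indicator_of_notMem hs]
  have key := lintegral_mul_prod_lintegral_pow_le (fun _ : Fin (n + 1) => (volume : Measure ℝ))
    (p := 1 / ((n : ℝ) + 1)) (by positivity) (by
      simp only [Fintype.card_fin, Nat.cast_add, Nat.cast_one, add_sub_cancel_right]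
      rw [mul_one_div, div_le_one hn]; linarith) hfm
  have hexp : 1 - (((Fintype.card (Fin (n + 1)) : ℕ) : ℝ) - 1) * (1 / ((n : ℝ) + 1)) =
      1 / ((n : ℝ) + 1) := by
    simp only [Fintype.card_fin, Nat.cast_add, Nat.cast_one, add_sub_cancel_right]
    field_simp; ring
  rw [hexp] at key
  calc ENNReal.ofReal L * volume X = ∫⁻ x, X.indicator (fun _ => ENNReal.ofReal L) x := by
        rw [lintegral_indicator_const hX.measurableSet]
    _ ≤ _ := lintegral_mono fun x => ?_
    _ ≤ _ := key
    _ ≤ _ := by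
        gcongr
        exact hfint
  by_cases hx : x ∈ X
  · rw [indicator_of_mem hx]
    calc ENNReal.ofReal L = 1 ^ (1 / ((n : ℝ) + 1)) *
          ∏ i : Fin (n + 1), ENNReal.ofReal L ^ (1 / ((n : ℝ) + 1)) := by
          rw [one_rpow, one_mul, Finset.prod_const, Finset.card_univ, Fintype.card_fin,
            ← rpow_natCast, ← rpow_mul, Nat.cast_add, Nat.cast_one, one_div_mul_cancel hn.ne',
            rpow_one]
      _ ≤ _ := by
          gcongr with i
          · exact h1 x hx
          · exact h2 x hx i
  · simp [indicator_of_notMem hx]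

theorem mul_volume_projection_le_of_volume_lt {n : ℕ} {t : ℝ} (ht0 : 0 < t) (ht2 : t ≤ 1 / 2)
    {A B : Set (Fin (n + 1) → ℝ)} (hA : IsCompact A) (hB : IsCompact B) {W : ℝ≥0∞}
    (hW0 : W ≠ 0) (hWtop : W ≠ ⊤) (hWA : W ≤ volume A) (hWB : W ≤ volume B)
    (hS : volume (t • A + (1 - t) • B) < ENNReal.ofReal (1 + t ^ (n + 1)) * W)
    (i : Fin (n + 1))
    (he : (∃ a ∈ A, ∃ b ∈ A, t • (a - b) = Pi.single i 1) ∨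
      ∃ a ∈ B, ∃ b ∈ B, (1 - t) • (a - b) = Pi.single i 1)
    (hdA : ∀ a ∈ A, ∀ b ∈ A, t * |a i - b i| ≤ 1)
    (hdB : ∀ a ∈ B, ∀ b ∈ B, (1 - t) * |a i - b i| ≤ 1) :
    ENNReal.ofReal (t ^ n * (1 - t) ^ (n + 1) / 8) *
      volume ((fun x j => x (i.succAbove j)) '' A) ≤ 2 * W := by
  let φ : (Fin (n + 1) → ℝ) →ₗ[ℝ] ℝ × (Fin n → ℝ) :=
    (LinearMap.proj i).prod (LinearMap.funLeft ℝ ℝ i.succAbove)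
  have hφ : ⇑φ = MeasurableEquiv.piFinSuccAbove (fun _ => ℝ) i := rfl
  have hφc : Continuous φ := φ.continuous_of_finiteDimensional
  have hφi : Function.Injective φ := by
    rw [hφ]; exact (MeasurableEquiv.piFinSuccAbove (fun _ => ℝ) i).injective
  have hvol : ∀ K, volume (φ '' K) = volume K := by
    intro K
    rw [← (volume_preserving_piFinSuccAbove (fun _ => ℝ) i).measure_preimage_equiv, ← hφ,
      preimage_image_eq _ hφi]
  have hφe : φ (Pi.single i 1) = (1, 0) := by
    refine Prod.ext ?_ ?_
    · simp [φ]
    · ext j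
      simp [φ, LinearMap.funLeft_apply]
  have hsum : φ '' (t • A + (1 - t) • B) = t • φ '' A + (1 - t) • φ '' B := by
    rw [image_add, image_smul_set, image_smul_set]
  have hfib : ∀ {r : ℝ} {K : Set (Fin (n + 1) → ℝ)}, (∀ a ∈ K, ∀ b ∈ K, r * |a i - b i| ≤ 1) →
      ∀ x p q, (p, x) ∈ φ '' K → (q, x) ∈ φ '' K → r * |p - q| ≤ 1 := by
    rintro r K h x p q ⟨a, ha, hpa⟩ ⟨b, hb, hqb⟩
    have h1 : a i = p := congrArg Prod.fst hpa
    have h2 : b i = q := congrArg Prod.fst hqb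
    rw [← h1, ← h2]
    exact h a ha b hb
  have key := mul_volume_image_snd_le_of_volume_lt ht0 ht2 (hA.image hφc) (hB.image hφc) hW0 hWtop
    (by rwa [hvol]) (by rwa [hvol]) (by rwa [← hsum, hvol]) (by
      refine he.imp ?_ ?_
      · rintro ⟨a, ha, b, hb, hab⟩
        exact ⟨_, mem_image_of_mem φ ha, _, mem_image_of_mem φ hb, by
          rw [← map_sub, ← map_smul, hab, hφe]⟩
      · rintro ⟨a, ha, b, hb, hab⟩
        exact ⟨_, mem_image_of_mem φ ha, _, mem_image_of_mem φ hb, by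
          rw [← map_sub, ← map_smul, hab, hφe]⟩) (hfib hdA) (hfib hdB)
  rwa [image_image] at key

/-- A quantitative lower bound for the volume in normalized position. -/
theorem exists_forall_one_le_mul_of_volume_lt (n : ℕ) {t : ℝ} (ht0 : 0 < t) (ht2 : t ≤ 1 / 2) :
    ∃ K : ℝ≥0∞, K ≠ ⊤ ∧ ∀ {A B : Set (Fin (n + 1) → ℝ)}, IsCompact A → IsCompact B →
      ∀ {W : ℝ≥0∞}, W ≠ 0 → W ≠ ⊤ → W ≤ volume A → W ≤ volume B →
      volume (t • A + (1 - t) • B) < ENNReal.ofReal (1 + t ^ (n + 1)) * W →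
      (∀ i, (∃ a ∈ A, ∃ b ∈ A, t • (a - b) = Pi.single i 1) ∨
        ∃ a ∈ B, ∃ b ∈ B, (1 - t) • (a - b) = Pi.single i 1) →
      (∀ a ∈ A, ∀ b ∈ A, ∀ i, t * |a i - b i| ≤ 1) →
      (∀ a ∈ B, ∀ b ∈ B, ∀ i, (1 - t) * |a i - b i| ≤ 1) → 1 ≤ K * W := by
  have ht1' : 0 < 1 - t := by linarith
  set c : ℝ := t ^ n * (1 - t) ^ (n + 1) / 8 with hc
  have hc0 : 0 < c := by positivity
  have hn : (0 : ℝ) < n + 1 := by positivity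
  set L : ℝ≥0∞ := ENNReal.ofReal t⁻¹ with hL
  have hL0 : L ≠ 0 := by simp [hL, ht0]
  set Q : ℝ≥0∞ := (n + 1) * (L * ((ENNReal.ofReal c)⁻¹ * 2)) with hQ
  have hcE : ENNReal.ofReal c ≠ 0 := by simp [hc0]
  have hQtop : Q ≠ ⊤ := by
    refine mul_ne_top (by finiteness) (mul_ne_top ofReal_ne_top (mul_ne_top ?_ (by norm_num)))
    simpa using hc0
  set R : ℝ≥0∞ := L⁻¹ * Q ^ (1 + 1 / ((n : ℝ) + 1)) with hR
  have hRtop : R ≠ ⊤ := mul_ne_top (inv_ne_top.2 hL0) (rpow_ne_top_of_nonneg (by positivity) hQtop)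
  refine ⟨R ^ (n + 1), pow_ne_top hRtop, ?_⟩
  intro A B hA hB W hW0 hWtop hWA hWB hS he hdA hdB
  have hA0 : A.Nonempty := by
    rw [nonempty_iff_ne_empty]
    rintro rfl
    simp [hW0] at hWA
  have hmin : ∀ i, ∃ m, IsLeast ((fun x : Fin (n + 1) → ℝ => x i) '' A) m := fun i =>
    (hA.image (continuous_apply i)).exists_isLeast (hA0.image _)
  choose a ha using hmin
  have hLW := mul_volume_le_of_volume_projections_le hA (L := t⁻¹) a
    (M := (ENNReal.ofReal c)⁻¹ * (2 * W)) (by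
      intro x hx i
      refine ⟨(ha i).2 ⟨x, hx, rfl⟩, ?_⟩
      obtain ⟨y, hy, hya⟩ := (ha i).1
      rw [← hya]
      have h1 := hdA x hx y hy i
      have h2 : |x i - y i| ≤ t⁻¹ := by
        rwa [← one_div, le_div_iff₀ ht0, mul_comm]
      have := (abs_le.1 h2).2
      dsimp only
      linarith) (by
      intro i
      have := mul_volume_projection_le_of_volume_lt ht0 ht2 hA hB hW0 hWtop hWA hWB hS i (he i)
        (fun a ha b hb => hdA a ha b hb i) (fun a ha b hb => hdB a ha b hb i)
      rwa [← hc, ENNReal.mul_le_iff_le_inv hcE ofReal_ne_top] at this)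
  have h1 : W ≤ R * (W * W ^ (1 / ((n : ℝ) + 1))) := by
    rw [← hL, ENNReal.mul_le_iff_le_inv hL0 ofReal_ne_top] at hLW
    refine hWA.trans (hLW.trans (le_of_eq ?_))
    have : ((n : ℝ≥0∞) + 1) * (L * ((ENNReal.ofReal c)⁻¹ * (2 * W))) = Q * W := by
      rw [hQ]; ring
    rw [this, mul_rpow_of_nonneg _ _ (by positivity), hR, mul_assoc,
      rpow_add 1 (1 / ((n : ℝ) + 1)) hW0 hWtop, rpow_one]
  have h2 : 1 ≤ R * W ^ (1 / ((n : ℝ) + 1)) := by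
    refine (ENNReal.mul_le_mul_iff_right hW0 hWtop).1 ?_
    rw [mul_one]
    refine h1.trans (le_of_eq ?_)
    ring
  calc (1 : ℝ≥0∞) ≤ (R * W ^ (1 / ((n : ℝ) + 1))) ^ (n + 1) := one_le_pow₀ h2
    _ = R ^ (n + 1) * W := by
      rw [mul_pow, ← rpow_natCast (W ^ _), ← rpow_mul, Nat.cast_add, Nat.cast_one,
        one_div_mul_cancel hn.ne', rpow_one]

end

section

open Set Filter Topology ENNReal

/-- A compact neighbourhood of the origin contains the vertices of, and is contained in, a
parallelepiped centered at the origin. -/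
theorem exists_linearEquiv_of_isCompact_of_mem_nhds {d : ℕ} {K : Set (Fin d → ℝ)}
    (hK : IsCompact K) (hK0 : K ∈ 𝓝 0) :
    ∃ T : (Fin d → ℝ) ≃ₗ[ℝ] (Fin d → ℝ), (∀ i, T (Pi.single i 1) ∈ K) ∧
      ∀ x ∈ K, ∀ i, |T.symm x i| ≤ 1 := by
  let D : (Fin d → Fin d → ℝ) → ℝ := fun e => |(Matrix.of e).transpose.det|
  have hDc : Continuous D :=
    (Continuous.matrix_det (Continuous.matrix_transpose continuous_id)).abs
  have hKc : IsCompact (univ.pi fun _ : Fin d => K) := isCompact_univ_pi fun _ => hK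
  have hr : ∃ r : ℝ, 0 < r ∧ ∀ i : Fin d, Pi.single i r ∈ K := by
    have h1 : ∀ i : Fin d, ∀ᶠ r : ℝ in 𝓝[>] 0, (Pi.single i r : Fin d → ℝ) ∈ K := by
      intro i
      have : Continuous fun r : ℝ => (Pi.single i r : Fin d → ℝ) :=
        continuous_single (A := fun _ : Fin d => ℝ) i
      have h2 := this.tendsto 0
      rw [Pi.single_zero] at h2
      exact (h2.mono_left nhdsWithin_le_nhds).eventually hK0
    obtain ⟨r, hr, hr0⟩ := ((eventually_all.2 h1).and self_mem_nhdsWithin).exists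
    exact ⟨r, hr0, hr⟩
  obtain ⟨r, hr0, hr⟩ := hr
  obtain ⟨e, he, hmax⟩ := hKc.exists_isMaxOn ⟨fun i => Pi.single i r, fun i _ => hr i⟩
    hDc.continuousOn
  set A : Matrix (Fin d) (Fin d) ℝ := (Matrix.of e).transpose with hA
  have hdet : A.det ≠ 0 := by
    have h1 : D (fun i => Pi.single i r) ≤ D e := hmax (fun i _ => hr i)
    have h2 : Matrix.of (fun i : Fin d => (Pi.single i r : Fin d → ℝ)) =
        Matrix.diagonal fun _ => r := by
      ext i j
      simp [Matrix.diagonal_apply, Pi.single_apply, eq_comm]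
    have h3 : 0 < D (fun i => Pi.single i r) := by
      simp only [D, h2, Matrix.det_transpose, Matrix.det_diagonal]
      positivity
    exact abs_pos.1 (h3.trans_le h1)
  have hunit : IsUnit (LinearMap.det (Matrix.toLin' A)) := by
    rw [LinearMap.det_toLin']; exact hdet.isUnit
  let T : (Fin d → ℝ) ≃ₗ[ℝ] (Fin d → ℝ) := LinearEquiv.ofIsUnitDet
    (v := Pi.basisFun ℝ (Fin d)) (v' := Pi.basisFun ℝ (Fin d)) (f := Matrix.toLin' A) (by
      rw [LinearMap.det_toMatrix]; exact hunit)
  have hT : ∀ y, T y = A.mulVec y := fun y => by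
    simp [T, Matrix.toLin'_apply]
  refine ⟨T, fun i => ?_, fun x hx i => ?_⟩
  · rw [hT, Matrix.mulVec_single_one]
    exact he i (mem_univ i)
  · have h1 : T.symm x = A.det⁻¹ • Matrix.cramer A x := by
      rw [LinearEquiv.symm_apply_eq, hT, Matrix.mulVec_smul, Matrix.mulVec_cramer, smul_smul,
        inv_mul_cancel₀ hdet, one_smul]
    have h2 : D (Function.update e i x) ≤ D e := by
      refine hmax fun j _ => ?_
      rcases eq_or_ne j i with rfl | hj
      · simpa using hx
      · simpa [hj] using he j (mem_univ j)
    have h3 : (Matrix.of (Function.update e i x)).transpose = A.updateCol i x := by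
      rw [hA, Matrix.updateCol_transpose]
      rfl
    rw [h1, Pi.smul_apply, Matrix.cramer_apply, smul_eq_mul, abs_mul, abs_inv, ← h3,
      inv_mul_le_iff₀ (abs_pos.2 hdet), mul_one]
    exact h2

/-- The stability estimate for compact sets with prescribed base points. -/
theorem exists_forall_volume_convexHull_le (n : ℕ) {t : ℝ} (ht0 : 0 < t) (ht2 : t ≤ 1 / 2) :
    ∃ C : ℝ≥0∞, C ≠ ⊤ ∧ ∀ {A B : Set (Fin (n + 1) → ℝ)}, IsCompact A → IsCompact B →
      ∀ {W : ℝ≥0∞}, W ≠ 0 → W ≠ ⊤ → W ≤ volume A → W ≤ volume B →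
      volume (t • A + (1 - t) • B) < ENNReal.ofReal (1 + t ^ (n + 1)) * W →
      ∀ a ∈ A, ∀ b ∈ B, volume (convexHull ℝ ((-a +ᵥ A) ∪ (-b +ᵥ B))) ≤ C * W := by
  have ht1' : 0 < 1 - t := by linarith
  obtain ⟨K, hK, hKW⟩ := exists_forall_one_le_mul_of_volume_lt n ht0 ht2
  refine ⟨ENNReal.ofReal (2 * t⁻¹) ^ (n + 1) * K, mul_ne_top (by finiteness) hK, ?_⟩
  intro A B hA hB W hW0 hWtop hWA hWB hS a ha b hb
  have hSig : IsCompact (t • (A - A) ∪ (1 - t) • (B - B)) :=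
    (((sub_eq_add_neg A A) ▸ hA.add hA.neg).smul t).union
      (((sub_eq_add_neg B B) ▸ hB.add hB.neg).smul (1 - t))
  have hSig0 : t • (A - A) ∪ (1 - t) • (B - B) ∈ 𝓝 0 := by
    refine mem_of_superset ?_ subset_union_left
    rw [set_smul_mem_nhds_zero_iff ht0.ne']
    exact Measure.sub_mem_nhds_zero_of_addHaar_pos volume A hA.measurableSet
      ((pos_iff_ne_zero.2 hW0).trans_le hWA)
  obtain ⟨T, hT1, hT2⟩ := exists_linearEquiv_of_isCompact_of_mem_nhds hSig hSig0
  have hTA : ∀ x ∈ A, ∀ y ∈ A, ∀ i, t * |T.symm x i - T.symm y i| ≤ 1 := by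
    intro x hx y hy i
    have := hT2 (t • (x - y)) (Or.inl (smul_mem_smul_set (sub_mem_sub hx hy))) i
    simpa [← mul_sub, abs_mul, abs_of_pos ht0] using this
  have hTB : ∀ x ∈ B, ∀ y ∈ B, ∀ i, (1 - t) * |T.symm x i - T.symm y i| ≤ 1 := by
    intro x hx y hy i
    have := hT2 ((1 - t) • (x - y)) (Or.inr (smul_mem_smul_set (sub_mem_sub hx hy))) i
    simpa [← mul_sub, abs_mul, abs_of_pos ht1'] using this
  set δ : ℝ≥0∞ := ENNReal.ofReal |LinearMap.det (T.symm : (Fin (n + 1) → ℝ) →ₗ[ℝ] _)| with hδ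
  have hvol : ∀ K : Set (Fin (n + 1) → ℝ), volume (T.symm '' K) = δ * volume K := fun K =>
    Measure.addHaar_image_linearMap volume (T.symm : (Fin (n + 1) → ℝ) →ₗ[ℝ] _) K
  have hδ0 : δ ≠ 0 := by
    simpa [hδ] using (LinearEquiv.isUnit_det' T.symm).ne_zero
  have hcont : Continuous T.symm := T.symm.toContinuousLinearEquiv.continuous
  have key : 1 ≤ K * (δ * W) := by
    refine hKW (A := T.symm '' A) (B := T.symm '' B) (hA.image hcont) (hB.image hcont)
      (mul_ne_zero hδ0 hW0) (mul_ne_top ofReal_ne_top hWtop)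
      (by rw [hvol]; gcongr) (by rw [hvol]; gcongr) ?_ ?_ ?_ ?_
    · have : t • T.symm '' A + (1 - t) • T.symm '' B = T.symm '' (t • A + (1 - t) • B) := by
        rw [image_add, image_smul_set, image_smul_set]
      rw [this, hvol, mul_left_comm]
      exact (ENNReal.mul_lt_mul_iff_right hδ0 ofReal_ne_top).2 hS
    · intro i
      refine (hT1 i).imp ?_ ?_
      · rintro ⟨_, ⟨x, hx, y, hy, rfl⟩, hxy⟩
        refine ⟨_, mem_image_of_mem _ hx, _, mem_image_of_mem _ hy, ?_⟩
        rw [← map_sub, ← map_smul, LinearEquiv.symm_apply_eq]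
        exact hxy
      · rintro ⟨_, ⟨x, hx, y, hy, rfl⟩, hxy⟩
        refine ⟨_, mem_image_of_mem _ hx, _, mem_image_of_mem _ hy, ?_⟩
        rw [← map_sub, ← map_smul, LinearEquiv.symm_apply_eq]
        exact hxy
    · rintro _ ⟨x, hx, rfl⟩ _ ⟨y, hy, rfl⟩ i
      exact hTA x hx y hy i
    · rintro _ ⟨x, hx, rfl⟩ _ ⟨y, hy, rfl⟩ i
      exact hTB x hx y hy i
  set H := convexHull ℝ ((-a +ᵥ A) ∪ (-b +ᵥ B)) with hH
  have hbox : T.symm '' H ⊆ Icc (fun _ => -t⁻¹) (fun _ => t⁻¹) := by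
    rw [hH, image_subset_iff]
    have hconv : Convex ℝ (T.symm ⁻¹' Icc (fun _ => -t⁻¹) (fun _ => t⁻¹)) :=
      (convex_Icc _ _).is_linear_preimage T.symm.toLinearMap.isLinear
    refine convexHull_min ?_ hconv
    have hmem : ∀ {r : ℝ} {x y : Fin (n + 1) → ℝ}, t ≤ r →
        (∀ i, r * |T.symm x i - T.symm y i| ≤ 1) →
        -y +ᵥ x ∈ T.symm ⁻¹' Icc (fun _ => -t⁻¹) (fun _ => t⁻¹) := by
      intro r x y hr h
      have h1 : ∀ i, |T.symm (-y +ᵥ x) i| ≤ t⁻¹ := by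
        intro i
        rw [vadd_eq_add, neg_add_eq_sub, map_sub, Pi.sub_apply, ← one_div, le_div_iff₀ ht0, mul_comm]
        exact (mul_le_mul_of_nonneg_right hr (abs_nonneg _)).trans (h i)
      exact ⟨fun i => (abs_le.1 (h1 i)).1, fun i => (abs_le.1 (h1 i)).2⟩
    rintro _ (⟨x, hx, rfl⟩ | ⟨x, hx, rfl⟩)
    · exact hmem le_rfl (hTA x hx a ha)
    · exact hmem (by linarith) (hTB x hx b hb)
  have hbv : δ * volume H ≤ ENNReal.ofReal (2 * t⁻¹) ^ (n + 1) := by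
    rw [← hvol]
    refine (measure_mono hbox).trans (le_of_eq ?_)
    rw [Real.volume_Icc_pi]
    simp [← two_mul]
  refine (ENNReal.mul_le_mul_iff_right hδ0 ofReal_ne_top).1 ?_
  calc δ * volume H ≤ ENNReal.ofReal (2 * t⁻¹) ^ (n + 1) * 1 := by rwa [mul_one]
    _ ≤ ENNReal.ofReal (2 * t⁻¹) ^ (n + 1) * (K * (δ * W)) := by gcongr
    _ = _ := by ring

end

section

open Set Filter Topology ENNReal

/-- If the convex hulls of all compact subsets of `A ∪ B` containing `K` and `L` are bounded in
volume, then so is the convex hull of `A ∪ B`. -/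
theorem volume_convexHull_union_le {d : ℕ} {A B K L : Set (Fin d → ℝ)} {M : ℝ≥0∞}
    (hK : IsCompact K) (hL : IsCompact L) (hKA : K ⊆ A) (hLB : L ⊆ B) (hK0 : K.Nonempty)
    (hL0 : L.Nonempty)
    (h : ∀ X Y, IsCompact X → IsCompact Y → K ⊆ X → L ⊆ Y → X ⊆ A → Y ⊆ B →
      volume (convexHull ℝ (X ∪ Y)) ≤ M) : volume (convexHull ℝ (A ∪ B)) ≤ M := by
  have : Nonempty A := (hK0.mono hKA).to_subtype
  have : Nonempty B := (hL0.mono hLB).to_subtype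
  obtain ⟨u, hu⟩ := TopologicalSpace.exists_dense_seq A
  obtain ⟨w, hw⟩ := TopologicalSpace.exists_dense_seq B
  let X : ℕ → Set (Fin d → ℝ) := fun k => K ∪ (fun i => (u i : Fin d → ℝ)) '' Iio k
  let Y : ℕ → Set (Fin d → ℝ) := fun k => L ∪ (fun i => (w i : Fin d → ℝ)) '' Iio k
  have hXY : Monotone fun k => convexHull ℝ (X k ∪ Y k) := by
    intro k l hkl
    refine convexHull_mono (union_subset_union (union_subset_union_right _ ?_)
      (union_subset_union_right _ ?_)) <;>
    exact image_mono (Iio_subset_Iio hkl)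
  have hXA : ∀ k, X k ⊆ A := fun k => union_subset hKA (by rintro _ ⟨i, _, rfl⟩; exact (u i).2)
  have hYB : ∀ k, Y k ⊆ B := fun k => union_subset hLB (by rintro _ ⟨i, _, rfl⟩; exact (w i).2)
  set U := ⋃ k, convexHull ℝ (X k ∪ Y k) with hU
  have hUM : volume U ≤ M := by
    rw [hU, hXY.measure_iUnion]
    exact iSup_le fun k => h _ _ (hK.union ((finite_Iio k).image _).isCompact)
      (hL.union ((finite_Iio k).image _).isCompact) subset_union_left subset_union_left
      (hXA k) (hYB k)
  have hUc : Convex ℝ U := hXY.directed_le.convex_iUnion fun k => convex_convexHull _ _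
  have hsub : convexHull ℝ (A ∪ B) ⊆ closure U := by
    refine convexHull_min (union_subset ?_ ?_) hUc.closure
    · intro x hx
      refine map_mem_closure continuous_subtype_val (hu ⟨x, hx⟩) ?_
      rintro _ ⟨i, rfl⟩
      exact mem_iUnion.2 ⟨i + 1, subset_convexHull _ _
        (Or.inl (Or.inr ⟨i, Nat.lt_succ_self i, rfl⟩))⟩
    · intro x hx
      refine map_mem_closure continuous_subtype_val (hw ⟨x, hx⟩) ?_
      rintro _ ⟨i, rfl⟩
      exact mem_iUnion.2 ⟨i + 1, subset_convexHull _ _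
        (Or.inr (Or.inr ⟨i, Nat.lt_succ_self i, rfl⟩))⟩
  calc volume (convexHull ℝ (A ∪ B)) ≤ volume (closure U) := measure_mono hsub
    _ ≤ volume (U ∪ frontier U) := measure_mono (by rw [closure_eq_self_union_frontier])
    _ ≤ volume U + volume (frontier U) := measure_union_le _ _
    _ ≤ M := by rwa [hUc.addHaar_frontier volume, add_zero]

end

/-- **Sharp threshold for stability of the Brunn–Minkowski inequality.**
For every `d ≥ 1` and `t ∈ (0, 1/2]` there is `C = C_{d,t} > 0` such that if
`A, B ⊆ ℝ^d` are measurable sets of equal positive finite volume with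
`|tA + (1-t)B| < (1 + t^d)|A|`, then after a translation
`|co(A ∪ B)| ≤ C |A|`. -/
theorem distinct_sets_threshold (d : ℕ) (hd : 1 ≤ d) (t : ℝ) (ht0 : 0 < t)
    (ht2 : t ≤ 1 / 2) :
    ∃ C : ℝ, 0 < C ∧
      ∀ A B : Set (Fin d → ℝ), MeasurableSet A → MeasurableSet B →
        volume A = volume B → 0 < volume A → volume A < ⊤ →
        volume (t • A + (1 - t) • B) < ENNReal.ofReal (1 + t ^ d) * volume A →
        ∃ v : Fin d → ℝ,
          volume (convexHull ℝ (A ∪ (v +ᵥ B))) ≤ ENNReal.ofReal C * volume A := by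
  obtain ⟨n, rfl⟩ := Nat.exists_eq_add_of_le' hd
  obtain ⟨C, hC, hCW⟩ := exists_forall_volume_convexHull_le n ht0 ht2
  refine ⟨C.toReal + 1, by positivity, ?_⟩
  intro A B hA hB hAB hA0 hAtop hS
  have hc : 0 < 1 + t ^ (n + 1) := by positivity
  have hc0 : ENNReal.ofReal (1 + t ^ (n + 1)) ≠ 0 := by simpa using hc
  obtain ⟨W, hSW, hWA⟩ := exists_between
    ((ENNReal.div_lt_iff (Or.inl hc0) (Or.inl ENNReal.ofReal_ne_top)).2 (by rwa [mul_comm] at hS))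
  rw [ENNReal.div_lt_iff (Or.inl hc0) (Or.inl ENNReal.ofReal_ne_top), mul_comm] at hSW
  have hW0 : W ≠ 0 := by
    rintro rfl
    simp at hSW
  obtain ⟨K, hKA, hK, hWK⟩ := hA.exists_lt_isCompact hWA
  obtain ⟨L, hLB, hL, hWL⟩ := hB.exists_lt_isCompact (hAB ▸ hWA)
  have hK0 : K.Nonempty := nonempty_of_measure_ne_zero (ne_bot_of_gt hWK)
  have hL0 : L.Nonempty := nonempty_of_measure_ne_zero (ne_bot_of_gt hWL)
  obtain ⟨a, ha⟩ := hK0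
  obtain ⟨b, hb⟩ := hL0
  refine ⟨a - b, ?_⟩
  calc volume (convexHull ℝ (A ∪ ((a - b) +ᵥ B))) ≤ C * W := ?_
    _ ≤ ENNReal.ofReal (C.toReal + 1) * volume A := by
      gcongr
      exact ENNReal.le_ofReal_iff_toReal_le hC (by positivity) |>.2 (by linarith)
  refine volume_convexHull_union_le hK (hL.vadd (a - b)) hKA (Set.vadd_set_mono hLB) ⟨a, ha⟩
    ⟨_, Set.vadd_mem_vadd_set hb⟩ ?_
  intro X Y hX hY hKX hLY hXA hYB
  have hLY' : L ⊆ (b - a) +ᵥ Y := by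
    rw [← neg_sub a b, ← Set.vadd_set_subset_iff_subset_neg_vadd_set]
    exact hLY
  have hYB' : (b - a) +ᵥ Y ⊆ B := by
    rw [← neg_sub a b, Set.vadd_set_subset_iff_subset_neg_vadd_set, neg_neg]
    exact hYB
  have key := hCW hX (hY.vadd (b - a)) hW0 hWA.ne_top (hWK.le.trans (measure_mono hKX))
    (hWL.le.trans (measure_mono hLY')) ((measure_mono (Set.add_subset_add
      (Set.smul_set_mono hXA) (Set.smul_set_mono hYB'))).trans_lt hSW) a (hKX ha) b (hLY' hb)
  rwa [vadd_vadd, neg_add_eq_sub, sub_sub_cancel_left, ← Set.vadd_set_union, convexHull_vadd,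
    measure_vadd] at key
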